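/- arXiv:math/0310219 — 2 statements merged into one kernel-verified Lean document; each statement's English description precedes it below -/
import Mathlib

section
/- On ℙ² over ℂ, for any nonnegative integers δ and μ, the linear system of plane curves of degree δ with 4 general base points of multiplicity μ is non-special; that is, h⁰ of the ideal sheaf twist equals max(0, (δ+1)(δ+2)/2 - 4·μ(μ+1)/2) — equivalently, the conditions imposed by 4 general μ-fold points on curves of degree δ are independent or the system is empty with h¹-vanishing on the blow-up. -/
open MvPolynomial

namespace FatPts

/-- the triangle `i + j < n` -/
def tri (n : ℕ) : Finset (ℕ × ℕ) :=
  (Finset.range n ×ˢ Finset.range n).filter (fun s => s.1 + s.2 < n)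

lemma mem_tri {n : ℕ} {s : ℕ × ℕ} : s ∈ tri n ↔ s.1 + s.2 < n := by
  simp only [tri, Finset.mem_filter, Finset.mem_product, Finset.mem_range]
  omega

lemma card_tri (n : ℕ) : 2 * (tri n).card = n * (n + 1) := by
  induction n with
  | zero => simp [tri]
  | succ n ih =>
    have h : tri (n + 1) = tri n ∪ Finset.HasAntidiagonal.antidiagonal n := by
      ext s
      simp only [Finset.mem_union, mem_tri, Finset.HasAntidiagonal.mem_antidiagonal]
      omega
    have hd : Disjoint (tri n) (Finset.HasAntidiagonal.antidiagonal n) := by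
      rw [Finset.disjoint_left]
      intro s hs hs'
      rw [mem_tri] at hs
      rw [Finset.HasAntidiagonal.mem_antidiagonal] at hs'
      omega
    rw [h, Finset.card_union_of_disjoint hd, Finset.Nat.card_antidiagonal]
    linarith

/-- test functions -/
noncomputable def G (i j : ℕ) (s : ℕ × ℕ) : ℂ :=
  (s.1.descFactorial i : ℂ) * (s.2.descFactorial j : ℂ)

noncomputable def U (n : ℕ) : Submodule ℂ (ℕ × ℕ → ℂ) :=
  Submodule.span ℂ {g | ∃ i j, i + j < n ∧ g = G i j}

lemma cast_desc_succ (n k : ℕ) :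
    (n.descFactorial (k + 1) : ℂ) = ((n : ℂ) - k) * (n.descFactorial k : ℂ) := by
  rw [Nat.descFactorial_succ]
  rcases le_or_gt k n with h | h
  · push_cast [Nat.cast_sub h]; ring
  · rw [Nat.descFactorial_eq_zero_iff_lt.2 h]; simp

lemma cast_desc (n k : ℕ) :
    (n.descFactorial k : ℂ) = ∏ l ∈ Finset.range k, ((n : ℂ) - l) := by
  induction k with
  | zero => simp
  | succ k ih => rw [cast_desc_succ, Finset.prod_range_succ, ih]; ring

lemma G_mem {i j n : ℕ} (h : i + j < n) : G i j ∈ U n :=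
  Submodule.subset_span ⟨i, j, h, rfl⟩

lemma U_mono {m n : ℕ} (h : m ≤ n) : U m ≤ U n := by
  apply Submodule.span_mono
  rintro g ⟨i, j, hij, rfl⟩
  exact ⟨i, j, by omega, rfl⟩

lemma mul_mem (α β γ : ℂ) {n : ℕ} {g : ℕ × ℕ → ℂ} (hg : g ∈ U n) :
    (fun s : ℕ × ℕ => (α + β * s.1 + γ * s.2) * g s) ∈ U (n + 1) := by
  unfold U at hg
  induction hg using Submodule.span_induction with
  | mem g h =>
    obtain ⟨i, j, hij, rfl⟩ := h
    have e : (fun s : ℕ × ℕ => (α + β * s.1 + γ * s.2) * G i j s) =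
        (α + β * i + γ * j) • G i j + β • G (i + 1) j + γ • G i (j + 1) := by
      funext s
      simp only [Pi.add_apply, Pi.smul_apply, smul_eq_mul, G, cast_desc_succ]
      ring
    rw [e]
    exact add_mem (add_mem (Submodule.smul_mem _ _ (G_mem (by omega)))
      (Submodule.smul_mem _ _ (G_mem (by omega)))) (Submodule.smul_mem _ _ (G_mem (by omega)))
  | zero =>
    convert (U (n + 1)).zero_mem using 1
    funext s
    simp
  | add x y _ _ hx hy =>
    have := add_mem hx hy
    convert this using 1
    funext s
    simp only [Pi.add_apply]
    ring
  | smul a x _ hx =>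
    have := Submodule.smul_mem _ a hx
    convert this using 1
    funext s
    simp only [Pi.smul_apply, smul_eq_mul]
    ring

lemma prod_mem (α β γ : ℂ) {n : ℕ} {g : ℕ × ℕ → ℂ} (hg : g ∈ U n) (l : ℕ) :
    (fun s : ℕ × ℕ => (∏ k ∈ Finset.range l, (α + β * s.1 + γ * s.2 - k)) * g s)
      ∈ U (n + l) := by
  induction l with
  | zero => simpa using hg
  | succ l ih =>
    have := mul_mem (α - l) β γ ih
    rw [← add_assoc]
    convert this using 1
    funext s
    rw [Finset.prod_range_succ]
    ring

lemma pairing {ι : Type*} [Fintype ι] (q : ι → ℕ × ℕ) (c : ι → ℂ) (μ : ℕ)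
    (h : ∀ i j, i + j < μ → ∑ s, c s * G i j (q s) = 0) {g : ℕ × ℕ → ℂ} (hg : g ∈ U μ) :
    ∑ s, c s * g (q s) = 0 := by
  unfold U at hg
  induction hg using Submodule.span_induction with
  | mem g hh =>
    obtain ⟨i, j, hij, rfl⟩ := hh
    exact h i j hij
  | zero => simp
  | add x y _ _ hx hy => simp [mul_add, Finset.sum_add_distrib, hx, hy]
  | smul a x _ hx =>
    have : ∀ s, c s * (a • x) (q s) = a * (c s * x (q s)) := by
      intro s; simp only [Pi.smul_apply, smul_eq_mul]; ring
    rw [Finset.sum_congr rfl (fun s _ => this s), ← Finset.mul_sum, hx, mul_zero]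

lemma prod_zero_of_lt {i n : ℕ} (h : i < n) :
    ∏ k ∈ Finset.range n, ((i : ℂ) - k) = 0 :=
  Finset.prod_eq_zero (Finset.mem_range.2 h) (by simp)

/-- uniqueness by Lagrange interpolation on the triangle -/
lemma uniq {ι : Type*} [Fintype ι] (q : ι → ℕ × ℕ) (hq : Function.Injective q)
    (c : ι → ℂ) (μ K : ℕ)
    (h : ∀ i j, i + j < μ → ∑ s, c s * G i j (q s) = 0)
    (hs : ∀ s, c s ≠ 0 → (q s).1 ≤ K ∧ (q s).2 ≤ K ∧ 2 * K < (q s).1 + (q s).2 + μ) :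
    c = 0 := by
  funext t
  by_contra ht
  obtain ⟨h1, h2, h3⟩ := hs t ht
  obtain ⟨i0, hi0⟩ := Nat.exists_eq_add_of_le h1
  obtain ⟨j0, hj0⟩ := Nat.exists_eq_add_of_le h2
  obtain ⟨l0, hl0⟩ : ∃ l0, i0 + j0 + l0 + 1 = μ := ⟨μ - 1 - i0 - j0, by omega⟩
  have hU := prod_mem ((μ : ℂ) - 1 - 2 * K) 1 1 (prod_mem (K : ℂ) 0 (-1)
    (prod_mem (K : ℂ) (-1) 0 (G_mem (i := 0) (j := 0) (n := 1) (by omega)) i0) j0) l0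
  have hU' := pairing q c μ h (U_mono (by omega) hU)
  have key : ∀ s, c s ≠ 0 → ∃ i j l : ℕ, i + j + l + 1 = μ ∧ (q s).1 + i = K ∧ (q s).2 + j = K ∧
      (∏ k ∈ Finset.range l0, (((μ : ℂ) - 1 - 2 * K) + 1 * (q s).1 + 1 * (q s).2 - k)) *
      ((∏ k ∈ Finset.range j0, ((K : ℂ) + 0 * (q s).1 + (-1) * (q s).2 - k)) *
      ((∏ k ∈ Finset.range i0, ((K : ℂ) + (-1) * (q s).1 + 0 * (q s).2 - k)) * G 0 0 (q s)))
      = (∏ k ∈ Finset.range l0, ((l : ℂ) - k)) * ((∏ k ∈ Finset.range j0, ((j : ℂ) - k)) *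
        (∏ k ∈ Finset.range i0, ((i : ℂ) - k))) := by
    intro s hcs
    obtain ⟨g1, g2, g3⟩ := hs s hcs
    obtain ⟨i, hi⟩ := Nat.exists_eq_add_of_le g1
    obtain ⟨j, hj⟩ := Nat.exists_eq_add_of_le g2
    obtain ⟨l, hl⟩ : ∃ l, i + j + l + 1 = μ := ⟨μ - 1 - i - j, by omega⟩
    refine ⟨i, j, l, hl, hi.symm, hj.symm, ?_⟩
    have e1 : (K : ℂ) = (q s).1 + i := by exact_mod_cast hi
    have e2 : (K : ℂ) = (q s).2 + j := by exact_mod_cast hj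
    have e3 : (μ : ℂ) = i + j + l + 1 := by exact_mod_cast hl.symm
    have f1 : (K : ℂ) + (-1) * (q s).1 + 0 * (q s).2 = i := by rw [e1]; ring
    have f2 : (K : ℂ) + 0 * (q s).1 + (-1) * (q s).2 = j := by rw [e2]; ring
    have f3 : ((μ : ℂ) - 1 - 2 * K) + 1 * (q s).1 + 1 * (q s).2 = l := by
      linear_combination e3 - e1 - e2
    rw [f1, f2, f3]
    simp [G]
  rw [Finset.sum_eq_single t] at hU'
  · obtain ⟨i, j, l, hl, hi, hj, e⟩ := key t ht
    rw [e] at hU'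
    have : i = i0 := by omega
    have : j = j0 := by omega
    have : l = l0 := by omega
    subst i j l
    rw [← cast_desc, ← cast_desc, ← cast_desc] at hU'
    simp only [Nat.descFactorial_self, mul_eq_zero, Nat.cast_eq_zero, Nat.factorial_ne_zero,
      or_false] at hU'
    exact ht hU'
  · intro s _ hst
    by_cases hcs : c s = 0
    · simp [hcs]
    · obtain ⟨i, j, l, hl, hi, hj, e⟩ := key s hcs
      rw [e]
      have : i < i0 ∨ j < j0 ∨ l < l0 := by
        by_contra hcon
        apply hst
        apply hq
        apply Prod.ext <;> omega
      rcases this with h | h | h <;> simp [prod_zero_of_lt h]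
  · simp

/-- exponent vector -/
noncomputable def ex (δ : ℕ) (s : ℕ × ℕ) : Fin 3 →₀ ℕ :=
  Finsupp.equivFunOnFinite.symm ![s.1, s.2, δ - s.1 - s.2]

lemma iter_pderiv (i : Fin 3) (n : ℕ) (s : Fin 3 →₀ ℕ) (a : ℂ) :
    (⇑(pderiv i))^[n] (monomial s a) =
      monomial (s - Finsupp.single i n) (a * ((s i).descFactorial n : ℂ)) := by
  induction n with
  | zero => simp
  | succ n ih =>
    rw [Function.iterate_succ_apply', ih, pderiv_monomial]
    have e : s - Finsupp.single i n - Finsupp.single i 1 = s - Finsupp.single i (n + 1) := by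
      rw [Finsupp.single_add, tsub_tsub]
    rw [e, Nat.descFactorial_succ]
    congr 1
    simp only [Finsupp.coe_tsub, Pi.sub_apply, Finsupp.single_eq_same]
    push_cast
    ring

/-- the derivative functional -/
noncomputable def dd (p : Fin 3 → ℂ) (m : Fin 3 → ℕ) : MvPolynomial (Fin 3) ℂ →ₗ[ℂ] ℂ :=
  (aeval p).toLinearMap ∘ₗ
    ((pderiv (0 : Fin 3)).toLinearMap ^ m 0 * (pderiv (1 : Fin 3)).toLinearMap ^ m 1 *
      (pderiv (2 : Fin 3)).toLinearMap ^ m 2)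

lemma dd_apply (p : Fin 3 → ℂ) (m : Fin 3 → ℕ) (f : MvPolynomial (Fin 3) ℂ) :
    dd p m f = eval (p)
                ((⇑(pderiv (0 : Fin 3)))^[m 0]
                  ((⇑(pderiv (1 : Fin 3)))^[m 1]
                    ((⇑(pderiv (2 : Fin 3)))^[m 2] f))) := by
  simp [dd, Module.End.mul_apply, Module.End.pow_apply, aeval_eq_eval]

lemma dd_monomial (p : Fin 3 → ℂ) (m : Fin 3 → ℕ) (δ : ℕ) (s : ℕ × ℕ) (a : ℂ) :
    dd p m (monomial (ex δ s) a) = a * ((s.1.descFactorial (m 0) : ℂ) *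
      (s.2.descFactorial (m 1) : ℂ) * ((δ - s.1 - s.2).descFactorial (m 2) : ℂ)) *
      (p 0 ^ (s.1 - m 0) * p 1 ^ (s.2 - m 1) * p 2 ^ (δ - s.1 - s.2 - m 2)) := by
  rw [dd_apply, iter_pderiv, iter_pderiv, iter_pderiv, eval_monomial,
    Finsupp.prod_fintype _ _ (by simp), Fin.prod_univ_three]
  have e0 : ex δ s 0 = s.1 := rfl
  have e1 : ex δ s 1 = s.2 := rfl
  have e2 : ex δ s 2 = δ - s.1 - s.2 := rfl
  simp only [Finsupp.coe_tsub, Pi.sub_apply, Finsupp.single_apply, e0, e1, e2]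
  simp
  ring_nf
  simp

/-- polynomial from coefficients -/
noncomputable def E (δ : ℕ) : (tri (δ + 1) → ℂ) →ₗ[ℂ] MvPolynomial (Fin 3) ℂ :=
  ∑ s : tri (δ + 1), (monomial (ex δ s.1)) ∘ₗ LinearMap.proj s

lemma E_apply (δ : ℕ) (c : tri (δ + 1) → ℂ) :
    E δ c = ∑ s : tri (δ + 1), monomial (ex δ s.1) (c s) := by
  simp [E]

lemma ex_inj (δ : ℕ) : Function.Injective (ex δ) := by
  intro s t h
  have h0 := DFunLike.congr_fun h 0
  have h1 := DFunLike.congr_fun h 1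
  simp [ex] at h0 h1
  exact Prod.ext h0 h1

lemma coeff_E (δ : ℕ) (c : tri (δ + 1) → ℂ) (s : tri (δ + 1)) :
    coeff (ex δ s.1) (E δ c) = c s := by
  classical
  rw [E_apply, coeff_sum, Finset.sum_eq_single s]
  · simp
  · intro t _ hts
    rw [coeff_monomial, if_neg]
    intro h
    exact hts (Subtype.ext (ex_inj δ h))
  · simp

lemma E_inj (δ : ℕ) : Function.Injective (E δ) := by
  intro c d h
  funext s
  rw [← coeff_E δ c s, h, coeff_E]

lemma ex_degree (δ : ℕ) (s : tri (δ + 1)) : (ex δ s.1).degree = δ := by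
  have := mem_tri.1 s.2
  rw [Finsupp.degree_eq_sum, Fin.sum_univ_three]
  simp [ex]
  omega

lemma E_hom (δ : ℕ) (c : tri (δ + 1) → ℂ) : (E δ c).IsHomogeneous δ := by
  rw [E_apply]
  exact IsHomogeneous.sum _ _ _ (fun s _ => isHomogeneous_monomial _ (ex_degree δ s))

lemma E_surj (δ : ℕ) (f : MvPolynomial (Fin 3) ℂ) (hf : f.IsHomogeneous δ) :
    ∃ c, E δ c = f := by
  refine ⟨fun s => coeff (ex δ s.1) f, ?_⟩
  ext d
  by_cases hd : d.degree = δ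
  · have h3 : d 0 + d 1 + d 2 = δ := by
      rw [Finsupp.degree_eq_sum, Fin.sum_univ_three] at hd
      exact hd
    have hm : (d 0, d 1) ∈ tri (δ + 1) := mem_tri.2 (by simp only; omega)
    have hde : d = ex δ (d 0, d 1) := by
      ext i
      fin_cases i
      · simp [ex]
      · simp [ex]
      · simp [ex]; omega
    have := coeff_E δ (fun s => coeff (ex δ s.1) f) ⟨(d 0, d 1), hm⟩
    rw [hde]
    exact this
  · rw [IsHomogeneous.coeff_eq_zero hf hd, IsHomogeneous.coeff_eq_zero (E_hom δ _) hd]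

/-- the points -/
def pt : Fin 4 → (Fin 3 → ℂ) := ![![1, 0, 0], ![0, 1, 0], ![0, 0, 1], ![1, 1, 1]]

noncomputable def V (δ μ : ℕ) : Submodule ℂ (MvPolynomial (Fin 3) ℂ) :=
  homogeneousSubmodule (Fin 3) ℂ δ ⊓
    ⨅ (i : Fin 4) (m : Fin 3 → ℕ) (_ : m 0 + m 1 + m 2 < μ), LinearMap.ker (dd (pt i) m)

lemma mem_V (δ μ : ℕ) (f : MvPolynomial (Fin 3) ℂ) : f ∈ V δ μ ↔ f.IsHomogeneous δ ∧
    ∀ i, ∀ m : Fin 3 → ℕ, m 0 + m 1 + m 2 < μ → dd (pt i) m f = 0 := by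
  simp [V, Submodule.mem_iInf]

def bad (δ μ : ℕ) (s : ℕ × ℕ) : Prop := s.1 + s.2 < μ ∨ δ < s.1 + μ ∨ δ < s.2 + μ

lemma dd_E (p : Fin 3 → ℂ) (m : Fin 3 → ℕ) (δ : ℕ) (c : tri (δ + 1) → ℂ) :
    dd p m (E δ c) = ∑ s : tri (δ + 1), c s * ((s.1.1.descFactorial (m 0) : ℂ) *
      (s.1.2.descFactorial (m 1) : ℂ) * ((δ - s.1.1 - s.1.2).descFactorial (m 2) : ℂ)) *
      (p 0 ^ (s.1.1 - m 0) * p 1 ^ (s.1.2 - m 1) * p 2 ^ (δ - s.1.1 - s.1.2 - m 2)) := by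
  rw [E_apply, map_sum]
  simp only [dd_monomial]

/-- a term of a derivative at a coordinate point vanishes for the wrong exponents -/
lemma term_zero {a k : ℕ} (h : a ≠ k) : (a.descFactorial k : ℂ) * (0 : ℂ) ^ (a - k) = 0 := by
  rcases lt_or_gt_of_ne h with h | h
  · rw [Nat.descFactorial_eq_zero_iff_lt.2 h]; simp
  · rw [zero_pow (by omega)]; simp

lemma E_mem_V (δ μ : ℕ) (c : tri (δ + 1) → ℂ) : E δ c ∈ V δ μ ↔
    (∀ s : tri (δ + 1), bad δ μ s.1 → c s = 0) ∧
    ∀ i j, i + j < μ → ∑ s : tri (δ + 1), c s * G i j s.1 = 0 := by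
  rw [mem_V]
  constructor
  · rintro ⟨-, h⟩
    constructor
    · intro s hs
      have hsm := mem_tri.1 s.2
      have hA : ∀ (i : Fin 4) (m : Fin 3 → ℕ), m 0 + m 1 + m 2 < μ →
          (∀ t : tri (δ + 1), t ≠ s → ((t.1.1.descFactorial (m 0) : ℂ) *
      (t.1.2.descFactorial (m 1) : ℂ) * ((δ - t.1.1 - t.1.2).descFactorial (m 2) : ℂ)) *
      (pt i 0 ^ (t.1.1 - m 0) * pt i 1 ^ (t.1.2 - m 1) * pt i 2 ^ (δ - t.1.1 - t.1.2 - m 2)) = 0) →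
        ((s.1.1.descFactorial (m 0) : ℂ) *
      (s.1.2.descFactorial (m 1) : ℂ) * ((δ - s.1.1 - s.1.2).descFactorial (m 2) : ℂ)) *
      (pt i 0 ^ (s.1.1 - m 0) * pt i 1 ^ (s.1.2 - m 1) * pt i 2 ^ (δ - s.1.1 - s.1.2 - m 2)) ≠ 0
        → c s = 0 := by
        intro i m hm h0 h1
        have := h i m hm
        rw [dd_E, Finset.sum_eq_single s] at this
        · rw [mul_assoc] at this
          exact (mul_eq_zero.1 this).resolve_right h1
        · intro t _ ht
          rw [mul_assoc, h0 t ht, mul_zero]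
        · simp
      rcases hs with hs | hs | hs
      · apply hA 2 ![s.1.1, s.1.2, 0] (by simpa using hs)
        · intro t ht
          have : t.1.1 ≠ s.1.1 ∨ t.1.2 ≠ s.1.2 := by
            by_contra hcon
            push Not at hcon
            exact ht (Subtype.ext (Prod.ext hcon.1 hcon.2))
          rcases this with h | h
          · simp [pt]
            have := term_zero h
            simp at this
            tauto
          · simp [pt]
            have := term_zero h
            simp at this
            tauto
        · simp [pt, Nat.factorial_ne_zero]
      · apply hA 0 ![0, s.1.2, δ - s.1.1 - s.1.2] (by simp; omega)
        · intro t ht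
          have htm := mem_tri.1 t.2
          have : t.1.2 ≠ s.1.2 ∨ δ - t.1.1 - t.1.2 ≠ δ - s.1.1 - s.1.2 := by
            by_contra hcon
            push Not at hcon
            exact ht (Subtype.ext (Prod.ext (by omega) hcon.1))
          rcases this with h | h
          · simp [pt]
            have := term_zero h
            simp at this
            tauto
          · simp [pt]
            have := term_zero h
            simp at this
            tauto
        · simp [pt, Nat.factorial_ne_zero]
      · apply hA 1 ![s.1.1, 0, δ - s.1.1 - s.1.2] (by simp; omega)
        · intro t ht
          have htm := mem_tri.1 t.2
          have : t.1.1 ≠ s.1.1 ∨ δ - t.1.1 - t.1.2 ≠ δ - s.1.1 - s.1.2 := by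
            by_contra hcon
            push Not at hcon
            exact ht (Subtype.ext (Prod.ext hcon.1 (by omega)))
          rcases this with h | h
          · simp [pt]
            have := term_zero h
            simp at this
            tauto
          · simp [pt]
            have := term_zero h
            simp at this
            tauto
        · simp [pt, Nat.factorial_ne_zero]
    · intro i j hij
      have := h 3 ![i, j, 0] (by simpa using hij)
      rw [dd_E] at this
      simpa [pt, G] using this
  · rintro ⟨hb, hG⟩
    refine ⟨E_hom δ c, ?_⟩
    have hcoord : ∀ (i : Fin 4) (m : Fin 3 → ℕ), (∀ s : tri (δ + 1), ¬ bad δ μ s.1 →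
      ((s.1.1.descFactorial (m 0) : ℂ) *
      (s.1.2.descFactorial (m 1) : ℂ) * ((δ - s.1.1 - s.1.2).descFactorial (m 2) : ℂ)) *
      (pt i 0 ^ (s.1.1 - m 0) * pt i 1 ^ (s.1.2 - m 1) * pt i 2 ^ (δ - s.1.1 - s.1.2 - m 2)) = 0)
      → dd (pt i) m (E δ c) = 0 := by
      intro i m h
      rw [dd_E]
      apply Finset.sum_eq_zero
      intro s _
      by_cases hs : bad δ μ s.1
      · rw [hb s hs]; simp
      · rw [mul_assoc, h s hs, mul_zero]
    intro i m hm
    by_cases hi : i = 3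
    · subst hi
      have hU := prod_mem (δ : ℂ) (-1) (-1) (G_mem (i := m 0) (j := m 1)
        (n := m 0 + m 1 + 1) (by omega)) (m 2)
      have := pairing (fun s : tri (δ + 1) => s.1) c μ hG (U_mono (by omega) hU)
      rw [dd_E, ← this]
      apply Finset.sum_congr rfl
      intro s _
      have hsm := mem_tri.1 s.2
      rw [cast_desc (δ - s.1.1 - s.1.2)]
      have e : ((δ - s.1.1 - s.1.2 : ℕ) : ℂ) = δ + (-1) * s.1.1 + (-1) * s.1.2 := by
        rw [Nat.sub_sub, Nat.cast_sub (by omega)]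
        push_cast
        ring
      rw [e]
      simp only [pt, G]
      simp only [Matrix.cons_val, one_pow, mul_one]
      ring
    · apply hcoord
      intro s hs
      have hsm := mem_tri.1 s.2
      unfold bad at hs
      have hi' : i = 0 ∨ i = 1 ∨ i = 2 := by omega
      rcases hi' with rfl | rfl | rfl
      · have : s.1.2 ≠ m 1 ∨ δ - s.1.1 - s.1.2 ≠ m 2 := by omega
        rcases this with h | h
        all_goals
          simp [pt]
          have := term_zero h
          simp at this
          tauto
      · have : s.1.1 ≠ m 0 ∨ δ - s.1.1 - s.1.2 ≠ m 2 := by omega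
        rcases this with h | h
        all_goals
          simp [pt]
          have := term_zero h
          simp at this
          tauto
      · have : s.1.1 ≠ m 0 ∨ s.1.2 ≠ m 1 := by omega
        rcases this with h | h
        all_goals
          simp [pt]
          have := term_zero h
          simp at this
          tauto

lemma finrank_V (δ μ : ℕ) :
    Module.finrank ℂ (V δ μ) = Module.finrank ℂ ((V δ μ).comap (E δ)) := by
  have h : V δ μ = ((V δ μ).comap (E δ)).map (E δ) := by
    rw [Submodule.map_comap_eq, eq_comm, inf_eq_right]
    intro f hf
    obtain ⟨c, hc⟩ := E_surj δ f ((mem_V δ μ f).1 hf).1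
    exact ⟨c, hc⟩
  conv_lhs => rw [h]
  exact (Submodule.equivMapOfInjective (E δ) (E_inj δ) _).finrank_eq.symm

open Classical in
noncomputable def B (δ μ : ℕ) : Finset (ℕ × ℕ) := (tri (δ + 1)).filter (bad δ μ)

lemma mem_B {δ μ : ℕ} {s : ℕ × ℕ} : s ∈ B δ μ ↔ s.1 + s.2 < δ + 1 ∧ bad δ μ s := by
  simp [B, mem_tri]

lemma card_B_le (δ μ : ℕ) : (B δ μ).card ≤ 3 * (tri μ).card := by
  have h : B δ μ ⊆ (tri μ ∪ (tri μ).image (fun s => (δ - s.1 - s.2, s.2))) ∪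
      (tri μ).image (fun s => (s.2, δ - s.1 - s.2)) := by
    rintro ⟨a, b⟩ hs
    obtain ⟨h1, h2⟩ := mem_B.1 hs
    simp only at h1
    simp only [Finset.mem_union, Finset.mem_image, mem_tri]
    rcases h2 with h2 | h2 | h2 <;> simp only at h2
    · exact Or.inl (Or.inl h2)
    · refine Or.inl (Or.inr ⟨(δ - a - b, b), by simp only; omega, ?_⟩)
      apply Prod.ext <;> simp only
      omega
    · refine Or.inr ⟨(δ - a - b, a), by simp only; omega, ?_⟩
      apply Prod.ext <;> simp only
      omega
  have h1 := Finset.card_le_card h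
  have h2 := Finset.card_union_le (tri μ ∪ (tri μ).image (fun s => (δ - s.1 - s.2, s.2)))
    ((tri μ).image (fun s => (s.2, δ - s.1 - s.2)))
  have h3 := Finset.card_union_le (tri μ) ((tri μ).image (fun s => (δ - s.1 - s.2, s.2)))
  have h4 := Finset.card_image_le (s := tri μ) (f := fun s => (δ - s.1 - s.2, s.2))
  have h5 := Finset.card_image_le (s := tri μ) (f := fun s => (s.2, δ - s.1 - s.2))
  omega

lemma lower (δ μ : ℕ) :
    (tri (δ + 1)).card ≤ Module.finrank ℂ ((V δ μ).comap (E δ)) + 4 * (tri μ).card := by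
  let Ψ : (tri (δ + 1) → ℂ) →ₗ[ℂ] (B δ μ → ℂ) × (tri μ → ℂ) :=
    LinearMap.prod
      (LinearMap.pi fun s => LinearMap.proj ⟨s.1, mem_tri.2 (mem_B.1 s.2).1⟩)
      (LinearMap.pi fun t => ∑ s : tri (δ + 1), G t.1.1 t.1.2 s.1 • LinearMap.proj s)
  have hk : LinearMap.ker Ψ ≤ (V δ μ).comap (E δ) := by
    intro c hc
    rw [LinearMap.mem_ker] at hc
    rw [Submodule.mem_comap, E_mem_V]
    have h1 := congrArg Prod.fst hc
    have h2 := congrArg Prod.snd hc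
    constructor
    · intro s hs
      exact congrFun h1 ⟨s.1, mem_B.2 ⟨mem_tri.1 s.2, hs⟩⟩
    · intro i j hij
      have := congrFun h2 ⟨(i, j), mem_tri.2 hij⟩
      simp only [Ψ, LinearMap.prod_apply, Pi.prod, LinearMap.pi_apply, LinearMap.sum_apply,
        LinearMap.smul_apply, LinearMap.proj_apply, smul_eq_mul] at this
      simpa [mul_comm] using this
  have h1 := Submodule.finrank_mono hk
  have h2 := LinearMap.finrank_range_add_finrank_ker Ψ
  have h3 := Submodule.finrank_le (LinearMap.range Ψ)
  rw [Module.finrank_prod] at h3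
  simp only [Module.finrank_fintype_fun_eq_card, Fintype.card_coe] at h2 h3
  have h4 := card_B_le δ μ
  omega

lemma small (δ μ : ℕ) (h : δ < 2 * μ) : Module.finrank ℂ ((V δ μ).comap (E δ)) = 0 := by
  have : (V δ μ).comap (E δ) = ⊥ := by
    rw [Submodule.eq_bot_iff]
    intro c hc
    rw [Submodule.mem_comap, E_mem_V] at hc
    apply uniq (fun s : tri (δ + 1) => s.1) Subtype.val_injective c μ (δ - μ) hc.2
    intro s hs
    have : ¬ bad δ μ s.1 := fun hb => hs (hc.1 s hb)
    have hsm := mem_tri.1 s.2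
    unfold bad at this
    omega
  rw [this, finrank_bot]

lemma upper (δ μ : ℕ) (h : 2 * μ ≤ δ) :
    Module.finrank ℂ ((V δ μ).comap (E δ)) + 4 * (tri μ).card ≤ (tri (δ + 1)).card := by
  classical
  let T1 := (tri μ).image (fun s => (δ - s.1 - s.2, s.2))
  let T2 := (tri μ).image (fun s => (s.2, δ - s.1 - s.2))
  let T3 := (tri μ).image (fun s => (μ - s.1, μ - s.2))
  have c1 : T1.card = (tri μ).card := by
    apply Finset.card_image_of_injOn
    rintro ⟨a, b⟩ hs ⟨a', b'⟩ ht he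
    have hs := mem_tri.1 (Finset.mem_coe.1 hs)
    have ht := mem_tri.1 (Finset.mem_coe.1 ht)
    simp only [Prod.mk.injEq] at he hs ht ⊢
    omega
  have c2 : T2.card = (tri μ).card := by
    apply Finset.card_image_of_injOn
    rintro ⟨a, b⟩ hs ⟨a', b'⟩ ht he
    have hs := mem_tri.1 (Finset.mem_coe.1 hs)
    have ht := mem_tri.1 (Finset.mem_coe.1 ht)
    simp only [Prod.mk.injEq] at he hs ht ⊢
    omega
  have c3 : T3.card = (tri μ).card := by
    apply Finset.card_image_of_injOn
    rintro ⟨a, b⟩ hs ⟨a', b'⟩ ht he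
    have hs := mem_tri.1 (Finset.mem_coe.1 hs)
    have ht := mem_tri.1 (Finset.mem_coe.1 ht)
    simp only [Prod.mk.injEq] at he hs ht ⊢
    omega
  have m1 : ∀ s, s ∈ T1 ↔ s.1 + s.2 ≤ δ ∧ δ < s.1 + μ := by
    rintro ⟨a, b⟩
    simp only [T1, Finset.mem_image, mem_tri, Prod.exists, Prod.mk.injEq]
    constructor
    · rintro ⟨x, y, hh⟩; omega
    · intro hh; exact ⟨δ - a - b, b, by omega⟩
  have m2 : ∀ s, s ∈ T2 ↔ s.1 + s.2 ≤ δ ∧ δ < s.2 + μ := by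
    rintro ⟨a, b⟩
    simp only [T2, Finset.mem_image, mem_tri, Prod.exists, Prod.mk.injEq]
    constructor
    · rintro ⟨x, y, hh⟩; omega
    · intro hh; exact ⟨δ - a - b, a, by omega⟩
  have m3 : ∀ s, s ∈ T3 ↔ s.1 ≤ μ ∧ s.2 ≤ μ ∧ μ < s.1 + s.2 := by
    rintro ⟨a, b⟩
    simp only [T3, Finset.mem_image, mem_tri, Prod.exists, Prod.mk.injEq]
    constructor
    · rintro ⟨x, y, hh⟩; omega
    · intro hh; exact ⟨μ - a, μ - b, by omega⟩
  let W := ((tri μ ∪ T1) ∪ T2) ∪ T3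
  have hW : W.card = 4 * (tri μ).card := by
    rw [Finset.card_union_of_disjoint, Finset.card_union_of_disjoint,
      Finset.card_union_of_disjoint, c1, c2, c3]
    · ring
    all_goals
      rw [Finset.disjoint_left]
      intro s
      simp only [Finset.mem_union, mem_tri, m1, m2, m3]
      omega
  have hWs : W ⊆ tri (δ + 1) := by
    intro s
    simp only [W, Finset.mem_union, mem_tri, m1, m2, m3]
    omega
  let C := tri (δ + 1) \ W
  have hC := Finset.card_sdiff_add_card_eq_card hWs
  let R : (tri (δ + 1) → ℂ) →ₗ[ℂ] (C → ℂ) :=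
    LinearMap.pi fun s => LinearMap.proj ⟨s.1, (Finset.mem_sdiff.1 s.2).1⟩
  have hinj : Function.Injective (R ∘ₗ ((V δ μ).comap (E δ)).subtype) := by
    rw [← LinearMap.ker_eq_bot, Submodule.eq_bot_iff]
    rintro ⟨c, hc⟩ hk
    rw [LinearMap.mem_ker] at hk
    rw [Submodule.mem_comap, E_mem_V] at hc
    apply Subtype.ext
    apply uniq (fun s : tri (δ + 1) => s.1) Subtype.val_injective c μ μ hc.2
    intro s hs
    have hb : ¬ bad δ μ s.1 := fun hb => hs (hc.1 s hb)
    have hsW : s.1 ∈ W := by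
      by_contra hsW
      exact hs (congrFun hk ⟨s.1, Finset.mem_sdiff.2 ⟨s.2, hsW⟩⟩)
    simp only [W, Finset.mem_union, mem_tri, m1, m2, m3] at hsW
    unfold bad at hb
    omega
  have := LinearMap.finrank_le_finrank_of_injective hinj
  simp only [Module.finrank_fintype_fun_eq_card, Fintype.card_coe] at this
  change _ ≤ C.card at this
  change C.card + _ = _ at hC
  omega

end FatPts

/-- Lemma 4.2 (case `c = 4`): on `ℙ²` over `ℂ`, the system of plane curves of degree
`δ` through `4` general points of multiplicity `μ` is non-special: the space of
degree-`δ` forms vanishing to order `≥ μ` at the points has dimension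
`max 0 ((δ+1)(δ+2)/2 - 4·μ(μ+1)/2)`. -/
theorem stmt17 (δ μ : ℕ) :
    ∃ p : Fin 4 → (Fin 3 → ℂ), (∀ i, p i ≠ 0) ∧
      ∃ V : Submodule ℂ (MvPolynomial (Fin 3) ℂ),
        (V : Set (MvPolynomial (Fin 3) ℂ)) =
          {f | f.IsHomogeneous δ ∧ ∀ i, ∀ m : Fin 3 → ℕ,
              m 0 + m 1 + m 2 < μ →
              eval (p i)
                ((⇑(pderiv (0 : Fin 3)))^[m 0]
                  ((⇑(pderiv (1 : Fin 3)))^[m 1]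
                    ((⇑(pderiv (2 : Fin 3)))^[m 2] f))) = 0} ∧
        (Module.finrank ℂ V : ℤ) =
          max 0 (((δ : ℤ) + 1) * ((δ : ℤ) + 2) / 2 - 4 * ((μ : ℤ) * (μ + 1) / 2)) := by
  refine ⟨FatPts.pt, ?_, FatPts.V δ μ, ?_, ?_⟩
  · intro i hi
    have h0 := congrFun hi 0
    have h1 := congrFun hi 1
    have h2 := congrFun hi 2
    fin_cases i <;> simp [FatPts.pt] at h0 h1 h2
  · ext f
    rw [SetLike.mem_coe, FatPts.mem_V]
    simp only [FatPts.dd_apply, Set.mem_setOf_eq]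
  · rw [FatPts.finrank_V]
    have t1 : ((δ : ℤ) + 1) * ((δ : ℤ) + 2) = 2 * ((FatPts.tri (δ + 1)).card : ℤ) := by
      have := FatPts.card_tri (δ + 1)
      zify at this
      linarith
    have t2 : (μ : ℤ) * (μ + 1) = 2 * ((FatPts.tri μ).card : ℤ) := by
      have := FatPts.card_tri μ
      zify at this
      linarith
    rw [t1, t2]
    have hl := FatPts.lower δ μ
    rcases lt_or_ge δ (2 * μ) with h | h
    · have := FatPts.small δ μ h
      omega
    · have := FatPts.upper δ μ h
      omega
end

section
/- On ℙ² over ℂ, for any nonnegative integers δ and μ, the linear system of plane curves of degree δ with 9 general base points of multiplicity μ is non-special; that is, its dimension equals max(-1, (δ² + 3δ)/2 - 9·μ(μ+1)/2). -/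
open MvPolynomial

namespace NinePts

abbrev P3 := MvPolynomial (Fin 3) ℂ

/-- iterated partial derivative -/
noncomputable def dd (a b c : ℕ) (f : P3) : P3 :=
  ((⇑(pderiv (0 : Fin 3)))^[a] ((⇑(pderiv (1 : Fin 3)))^[b] ((⇑(pderiv (2 : Fin 3)))^[c] f)))

/-- vanishing to order `μ` at `p` -/
def Van (p : Fin 3 → ℂ) (μ : ℕ) (f : P3) : Prop :=
  ∀ a b c : ℕ, a + b + c < μ → eval p (dd a b c f) = 0

lemma pderiv_comm' (i j : Fin 3) (f : P3) :
    pderiv i (pderiv j f) = pderiv j (pderiv i f) := by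
  ext m
  simp only [coeff_pderiv]
  by_cases h : i = j
  · subst h; rfl
  · simp only [Finsupp.add_apply, Finsupp.single_apply, if_neg h, if_neg (Ne.symm h)]
    rw [add_right_comm]
    simp only [add_zero]
    ring

lemma coeff_iter (i : Fin 3) (k : ℕ) : ∀ d : Fin 3 →₀ ℕ, ∃ c : ℂ, c ≠ 0 ∧ ∀ f : P3,
    coeff d ((⇑(pderiv i))^[k] f) = c * coeff (d + Finsupp.single i k) f := by
  induction k with
  | zero => intro d; exact ⟨1, one_ne_zero, fun f => by simp⟩
  | succ k ih =>
    intro d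
    obtain ⟨c, hc, h⟩ := ih (d + Finsupp.single i 1)
    refine ⟨(d i + 1) * c, mul_ne_zero (Nat.cast_add_one_ne_zero _) hc, fun f => ?_⟩
    rw [Function.iterate_succ_apply', coeff_pderiv, h, add_assoc, ← Finsupp.single_add,
      add_comm 1 k]
    ring

/-- translation -/
noncomputable def tau (p : Fin 3 → ℂ) : P3 →ₐ[ℂ] P3 := aeval (fun i => X i + C (p i))

lemma tau_pderiv (p : Fin 3 → ℂ) (i : Fin 3) (f : P3) :
    tau p (pderiv i f) = pderiv i (tau p f) := by
  induction f using MvPolynomial.induction_on with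
  | C a => simp [tau, algebraMap_eq]
  | add f g hf hg => simp [hf, hg]
  | mul_X f j hf =>
    simp only [Derivation.leibniz, map_add, map_mul, smul_eq_mul, hf]
    congr 2
    simp only [tau, aeval_X, map_add, pderiv_C, add_zero, pderiv_X]
    by_cases h : j = i <;> simp [h]

lemma tau_iter (p : Fin 3 → ℂ) (i : Fin 3) (k : ℕ) (f : P3) :
    tau p ((⇑(pderiv i))^[k] f) = (⇑(pderiv i))^[k] (tau p f) := by
  induction k with
  | zero => rfl
  | succ k ih => rw [Function.iterate_succ_apply', Function.iterate_succ_apply', tau_pderiv, ih]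

lemma eval_tau (p : Fin 3 → ℂ) (f : P3) : eval p f = coeff 0 (tau p f) := by
  rw [← constantCoeff_eq]
  induction f using MvPolynomial.induction_on with
  | C a => simp [tau, algebraMap_eq]
  | add f g hf hg => simp [hf, hg]
  | mul_X f j hf => simp [hf]; simp [tau]

lemma fin3_decomp (d : Fin 3 →₀ ℕ) :
    0 + Finsupp.single 0 (d 0) + Finsupp.single 1 (d 1) + Finsupp.single 2 (d 2) = d := by
  ext i; fin_cases i <;> simp

lemma deg3 (d : Fin 3 →₀ ℕ) : d.degree = d 0 + d 1 + d 2 := by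
  rw [Finsupp.degree_eq_sum, Fin.sum_univ_three]

lemma van_iff (p : Fin 3 → ℂ) (μ : ℕ) (f : P3) :
    Van p μ f ↔ ∀ d : Fin 3 →₀ ℕ, d.degree < μ → coeff d (tau p f) = 0 := by
  have key : ∀ d : Fin 3 →₀ ℕ, eval p (dd (d 0) (d 1) (d 2) f) = 0 ↔ coeff d (tau p f) = 0 := by
    intro d
    rw [eval_tau, dd, tau_iter, tau_iter, tau_iter]
    obtain ⟨c0, h0, e0⟩ := coeff_iter 0 (d 0) 0
    obtain ⟨c1, h1, e1⟩ := coeff_iter 1 (d 1) (0 + Finsupp.single 0 (d 0))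
    obtain ⟨c2, h2, e2⟩ := coeff_iter 2 (d 2) (0 + Finsupp.single 0 (d 0) + Finsupp.single 1 (d 1))
    rw [e0, e1, e2, fin3_decomp]
    simp [h0, h1, h2]
  constructor
  · intro h d hd
    exact (key d).1 (h _ _ _ (by rwa [deg3] at hd))
  · intro h a b c hd
    have := (key (Finsupp.equivFunOnFinite.symm ![a, b, c])).2 (h _ (by rw [deg3]; simpa using hd))
    simpa using this

lemma van_mul (p : Fin 3 → ℂ) (μ : ℕ) (f g : P3) (d : Fin 3 →₀ ℕ) (hd : d.degree = 1)
    (hf : coeff d (tau p f) ≠ 0) (h : Van p (μ + 1) (f * g)) : Van p μ g := by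
  rw [van_iff] at h ⊢
  set F : MvPowerSeries (Fin 3) ℂ := MvPolynomial.toMvPowerSeries (tau p f) with hF
  set G : MvPowerSeries (Fin 3) ℂ := MvPolynomial.toMvPowerSeries (tau p g) with hG
  have h1 : ((μ + 1 : ℕ) : ℕ∞) ≤ (F * G).order := by
    apply MvPowerSeries.nat_le_order
    intro e he
    rw [hF, hG, ← MvPolynomial.coe_mul, MvPolynomial.coeff_coe, ← map_mul]
    exact h e he
  rw [MvPowerSeries.order_mul] at h1
  have h2 : F.order ≤ (1 : ℕ) := by
    rw [← hd]; apply MvPowerSeries.order_le; rwa [hF, MvPolynomial.coeff_coe]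
  have h3 : (μ : ℕ∞) ≤ G.order := by
    have : ((μ + 1 : ℕ) : ℕ∞) ≤ (1 : ℕ) + G.order := h1.trans (by gcongr)
    rw [add_comm μ 1, Nat.cast_add] at this
    exact (ENat.add_le_add_iff_left (by simp)).1 this
  intro e he
  have := MvPowerSeries.coeff_of_lt_order (f := G) (d := e) (lt_of_lt_of_le (by exact_mod_cast he) h3)
  rwa [hG, MvPolynomial.coeff_coe] at this

/-- Euler reduction. -/
lemma dd_succ0 (a b c : ℕ) (f : P3) : pderiv 0 (dd a b c f) = dd (a+1) b c f := by
  simp only [dd, Function.iterate_succ_apply']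

lemma comm_iter (i j : Fin 3) (k : ℕ) (f : P3) :
    pderiv i ((⇑(pderiv j))^[k] f) = (⇑(pderiv j))^[k] (pderiv i f) := by
  induction k with
  | zero => rfl
  | succ k ih => rw [Function.iterate_succ_apply', Function.iterate_succ_apply', pderiv_comm', ih]

lemma dd_succ1 (a b c : ℕ) (f : P3) : pderiv 1 (dd a b c f) = dd a (b+1) c f := by
  simp only [dd, Function.iterate_succ_apply', comm_iter 1 0]

lemma dd_succ2 (a b c : ℕ) (f : P3) : pderiv 2 (dd a b c f) = dd a b (c+1) f := by
  simp only [dd, Function.iterate_succ_apply', comm_iter 2 0, comm_iter 2 1]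

lemma iter_hom (i : Fin 3) (k : ℕ) (f : P3) (n : ℕ) (h : f.IsHomogeneous n) :
    ((⇑(pderiv i))^[k] f).IsHomogeneous (n - k) := by
  induction k with
  | zero => simpa
  | succ k ih => rw [Function.iterate_succ_apply']; exact ih.pderiv

lemma euler_red (p : Fin 3 → ℂ) (hp : p 1 = 1) (μ δ : ℕ) (f : P3) (hf : f.IsHomogeneous δ)
    (h : ∀ a c, a + c < μ → eval p (dd a 0 c f) = 0) : Van p μ f := by
  intro a b
  induction b generalizing a with
  | zero => intro c hc; exact h a c (by omega)
  | succ b ih =>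
    intro c hc
    have hh : (dd a b c f).IsHomogeneous (δ - c - b - a) :=
      iter_hom _ _ _ _ (iter_hom _ _ _ _ (iter_hom _ _ _ _ hf))
    have e := hh.sum_X_mul_pderiv
    rw [Fin.sum_univ_three, dd_succ0, dd_succ1, dd_succ2] at e
    have e2 := congrArg (eval p) e
    simp only [map_add, map_mul, eval_X, hp, map_nsmul, ih a c (by omega),
      ih (a+1) c (by omega), ih a (c+1) (by omega)] at e2
    simpa using e2


lemma finrank_hom (n : ℕ) :
    Module.finrank ℂ (homogeneousSubmodule (Fin 3) ℂ n) = (n + 2).choose 2 := by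
  have e : homogeneousSubmodule (Fin 3) ℂ n = restrictSupport ℂ {d | d.degree = n} :=
    homogeneousSubmodule_eq_finsupp_supported _ _ n
  rw [e, Module.finrank_eq_nat_card_basis (basisRestrictSupport ℂ _)]
  have : {d : Fin 3 →₀ ℕ | d.degree = n} =
      ((Finset.univ : Finset (Fin 3)).finsuppAntidiag n : Set (Fin 3 →₀ ℕ)) := by
    ext d
    simp [Finset.mem_finsuppAntidiag, Finsupp.degree_eq_sum]
  rw [this]
  simp only [SetLike.coe_sort_coe, Nat.card_eq_fintype_card, Fintype.card_coe]
  rw [Finset.card_finsuppAntidiag_nat_eq_choose]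
  simp only [Finset.card_univ, Fintype.card_fin]
  rw [show 3 + n - 1 = n + 2 by omega, Nat.choose_symm_add]

instance (n : ℕ) : FiniteDimensional ℂ (homogeneousSubmodule (Fin 3) ℂ n) :=
  Module.Finite.iff_fg.2 (homogeneousSubmodule_fg _ _ n)

/-- the points, on the cuspidal cubic -/
noncomputable def cpt (t : ℂ) : Fin 3 → ℂ := ![t, 1, t ^ 3]

noncomputable def pt (i : Fin 9) : Fin 3 → ℂ := cpt ((i : ℕ) : ℂ)

/-- the linear system -/
noncomputable def V (δ μ : ℕ) : Submodule ℂ P3 where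
  carrier := {f | f.IsHomogeneous δ ∧ ∀ i, Van (pt i) μ f}
  zero_mem' := ⟨isHomogeneous_zero _ _ _, fun i => by rw [van_iff]; simp⟩
  add_mem' := by
    rintro f g ⟨hf, hf'⟩ ⟨hg, hg'⟩
    refine ⟨hf.add hg, fun i => ?_⟩
    have h1 := hf' i
    have h2 := hg' i
    rw [van_iff] at *
    intro d hd
    simp [h1 d hd, h2 d hd]
  smul_mem' := by
    rintro c f ⟨hf, hf'⟩
    refine ⟨(homogeneousSubmodule (Fin 3) ℂ δ).smul_mem c hf, fun i => ?_⟩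
    have h1 := hf' i
    rw [van_iff] at *
    intro d hd
    simp [h1 d hd]

lemma V_le (δ μ : ℕ) : V δ μ ≤ homogeneousSubmodule (Fin 3) ℂ δ := fun _ h => h.1

instance (δ μ : ℕ) : FiniteDimensional ℂ (V δ μ) :=
  Submodule.finiteDimensional_of_le (V_le δ μ)

noncomputable def ddL (a b c : ℕ) : P3 →ₗ[ℂ] P3 :=
  (pderiv (0 : Fin 3)).toLinearMap ^ a * ((pderiv (1 : Fin 3)).toLinearMap ^ b *
    (pderiv (2 : Fin 3)).toLinearMap ^ c)

lemma ddL_apply (a b c : ℕ) (f : P3) : ddL a b c f = dd a b c f := by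
  simp only [ddL, dd, Module.End.mul_apply, Module.End.pow_apply]
  rfl

abbrev Idx (μ : ℕ) := Fin 9 × (Σ n : Fin μ, Fin (n + 1))

lemma card_idx (μ : ℕ) : Fintype.card (Idx μ) = 9 * (μ + 1).choose 2 := by
  simp only [Fintype.card_prod, Fintype.card_fin, Fintype.card_sigma]
  rw [Fin.sum_univ_eq_sum_range (fun n => n + 1)]
  congr 1
  induction μ with
  | zero => rfl
  | succ μ ih => rw [Finset.sum_range_succ, ih, Nat.choose_succ_succ' (μ + 1) 1]; simp [add_comm]

noncomputable def condL (μ : ℕ) : P3 →ₗ[ℂ] (Idx μ → ℂ) :=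
  LinearMap.pi fun x => (aeval (pt x.1) : P3 →ₐ[ℂ] ℂ).toLinearMap ∘ₗ
    ddL x.2.2 0 (x.2.1 - x.2.2)

/-- general dimension estimate -/
lemma finrank_le_of_ker {ι : Type} [Fintype ι] (A W : Submodule ℂ P3) [FiniteDimensional ℂ A]
    [FiniteDimensional ℂ W] (φ : P3 →ₗ[ℂ] (ι → ℂ)) (h : ∀ f ∈ A, φ f = 0 → f ∈ W) :
    Module.finrank ℂ A ≤ Fintype.card ι + Module.finrank ℂ W := by
  have h1 := LinearMap.finrank_range_add_finrank_ker (φ ∘ₗ A.subtype)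
  have h2 : Module.finrank ℂ (LinearMap.range (φ ∘ₗ A.subtype)) ≤ Fintype.card ι := by
    refine (Submodule.finrank_le _).trans ?_
    simp
  have h3 : Module.finrank ℂ (LinearMap.ker (φ ∘ₗ A.subtype)) ≤ Module.finrank ℂ W := by
    rw [← Submodule.finrank_map_subtype_eq]
    apply Submodule.finrank_mono
    rintro _ ⟨x, hx, rfl⟩
    exact h x x.2 hx
  omega

lemma lower (δ μ : ℕ) :
    (δ + 2).choose 2 ≤ 9 * (μ + 1).choose 2 + Module.finrank ℂ (V δ μ) := by
  rw [← finrank_hom, ← card_idx]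
  apply finrank_le_of_ker _ _ (condL μ)
  intro f hf h
  refine ⟨hf, fun i => euler_red (pt i) rfl μ δ f hf fun a c hac => ?_⟩
  have := congrFun h (i, ⟨⟨a + c, hac⟩, ⟨a, by simp⟩⟩)
  simpa [condL, ddL_apply, aeval_eq_eval] using this

/-- restriction to the cuspidal cubic -/
noncomputable def R : P3 →ₐ[ℂ] Polynomial ℂ := aeval ![Polynomial.X, 1, Polynomial.X ^ 3]

lemma R_dvd (t : ℂ) (μ : ℕ) (f : P3) (h : Van (cpt t) μ f) :
    (Polynomial.X - Polynomial.C t) ^ μ ∣ R f := by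
  rw [van_iff] at h
  set r : Fin 3 → Polynomial ℂ := ![Polynomial.X, 1, Polynomial.X ^ 3] with hr
  set s : Fin 3 → Polynomial ℂ := fun i => r i - Polynomial.C (cpt t i) with hs
  have e : (aeval s : P3 →ₐ[ℂ] _).comp (tau (cpt t)) = R := by
    apply MvPolynomial.algHom_ext
    intro i
    simp [tau, R, ← hr, hs, ← algebraMap_eq, ← Polynomial.algebraMap_eq]
  rw [← e, AlgHom.comp_apply, aeval_def, eval₂_eq']
  apply Finset.dvd_sum
  intro d hd
  apply Dvd.dvd.mul_left
  have hd' : μ ≤ d.degree := by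
    by_contra hlt
    exact (mem_support_iff.1 hd) (h d (by omega))
  refine (pow_dvd_pow _ hd').trans ?_
  rw [Finsupp.degree_eq_sum, ← Finset.prod_pow_eq_pow_sum]
  apply Finset.prod_dvd_prod_of_dvd
  intro i _
  apply pow_dvd_pow_of_dvd
  fin_cases i
  · simp [hs, hr, cpt]
  · simp [hs, hr, cpt]
  · simpa [hs, hr, cpt] using sub_dvd_pow_sub_pow (Polynomial.X : Polynomial ℂ) (Polynomial.C t) 3

lemma R_eq (f : P3) : R f =
    ∑ d ∈ f.support, Polynomial.C (coeff d f) * Polynomial.X ^ (d 0 + 3 * d 2) := by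
  rw [R, aeval_def, eval₂_eq']
  refine Finset.sum_congr rfl fun d _ => ?_
  rw [Fin.prod_univ_three]
  simp [pow_add, pow_mul, Polynomial.algebraMap_eq]

lemma hom_deg {δ : ℕ} {f : P3} (hf : f.IsHomogeneous δ) {d : Fin 3 →₀ ℕ} (hd : d ∈ f.support) :
    d 0 + d 1 + d 2 = δ := by
  rw [← deg3]
  have := (homogeneousSubmodule_eq_finsupp_supported (Fin 3) ℂ δ).le hf
  exact this hd

lemma R_coeff (δ : ℕ) (f : P3) (hf : f.IsHomogeneous δ) (n : ℕ) (hn : 3 * δ < n ∨ n + 1 = 3 * δ) :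
    (R f).coeff n = 0 := by
  rw [R_eq, Polynomial.finsetSum_coeff]
  apply Finset.sum_eq_zero
  intro d hd
  have := hom_deg hf hd
  rw [Polynomial.coeff_C_mul_X_pow, if_neg]
  omega

/-- the cubic -/
noncomputable def cub : P3 := X 1 ^ 2 * X 2 - X 0 ^ 3

lemma R_cub : R cub = 0 := by simp [R, cub]

lemma cub_tau (t : ℂ) : coeff (Finsupp.single 2 1) (tau (cpt t) cub) ≠ 0 := by
  have := coeff_pderiv (i := (2 : Fin 3)) (tau (cpt t) cub) 0
  rw [← tau_pderiv, ← eval_tau] at this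
  intro h
  rw [zero_add, h] at this
  revert this
  simp [cub, cpt, Derivation.leibniz_pow]

lemma division (δ : ℕ) : homogeneousSubmodule (Fin 3) ℂ δ ≤
    (restrictSupport ℂ {d : Fin 3 →₀ ℕ | d.degree + 3 = δ}).map (LinearMap.mulLeft ℂ cub) ⊔
      restrictSupport ℂ {d : Fin 3 →₀ ℕ | d.degree = δ ∧ d 0 < 3} := by
  have e : homogeneousSubmodule (Fin 3) ℂ δ = restrictSupport ℂ {d | d.degree = δ} :=
    homogeneousSubmodule_eq_finsupp_supported _ _ δ
  rw [e, restrictSupport_eq_span, Submodule.span_le]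
  rintro _ ⟨d, hd, rfl⟩
  simp only [SetLike.mem_coe]
  change d.degree = δ at hd
  induction hn : d 0 using Nat.strong_induction_on generalizing d with
  | _ n ih =>
  by_cases h3 : d 0 < 3
  · apply Submodule.mem_sup_right
    rw [monomial_mem_restrictSupport]
    exact Or.inl ⟨hd, h3⟩
  · push Not at h3
    obtain ⟨e, rfl⟩ : ∃ e, d = e + Finsupp.single 0 3 := by
      refine ⟨d - Finsupp.single 0 3, ?_⟩
      rw [tsub_add_cancel_of_le]
      simpa using h3
    rw [deg3] at hd
    simp at hd
    have key : (monomial (e + Finsupp.single 0 3) (1:ℂ) : P3) =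
        monomial (e + Finsupp.single 1 2 + Finsupp.single 2 1) 1 - cub * monomial e 1 := by
      have h1 : (X 0 ^ 3 : P3) = monomial (Finsupp.single 0 3) 1 := X_pow_eq_monomial
      have h2 : (X 1 ^ 2 : P3) = monomial (Finsupp.single 1 2) 1 := X_pow_eq_monomial
      have h3 : (X 2 : P3) = monomial (Finsupp.single 2 1) 1 := rfl
      rw [cub, h1, h2, h3, sub_mul, monomial_mul, monomial_mul, monomial_mul,
        add_comm (Finsupp.single 0 3) e, add_comm _ e, ← add_assoc]
      simp
    rw [key]
    apply Submodule.sub_mem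
    · refine ih (e 0) ?_ _ ?_ ?_
      · simp at hn; omega
      · rw [deg3]; simp; omega
      · simp
    · apply Submodule.mem_sup_left
      refine ⟨monomial e 1, ?_, rfl⟩
      rw [SetLike.mem_coe, monomial_mem_restrictSupport]
      left
      change e.degree + 3 = δ
      rw [deg3]; omega

lemma R_inj (δ : ℕ) (f : P3) (hf : f ∈ restrictSupport ℂ {d : Fin 3 →₀ ℕ | d.degree = δ ∧ d 0 < 3})
    (h : R f = 0) : f = 0 := by
  rw [mem_restrictSupport_iff] at hf
  by_contra hne
  obtain ⟨d, hd⟩ := MvPolynomial.ne_zero_iff.1 hne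
  have hd' : d ∈ f.support := mem_support_iff.2 hd
  have h' := congrArg (fun P => Polynomial.coeff P (d 0 + 3 * d 2)) h
  simp only [R_eq, Polynomial.finsetSum_coeff, Polynomial.coeff_C_mul_X_pow,
    Polynomial.coeff_zero] at h'
  rw [Finset.sum_eq_single d] at h'
  · simp at h'; exact hd h'
  · intro b hb hbd
    rw [if_neg]
    intro heq
    apply hbd
    have h1 := hf hb
    have h2 := hf hd'
    simp only [Set.mem_ofPred_eq, deg3] at h1 h2
    ext i
    fin_cases i <;> simp <;> omega
  · intro h; exact absurd hd' h

lemma ker_R (δ μ : ℕ) (f : P3) (hf : f ∈ V δ (μ + 1)) (h : R f = 0) :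
    (3 ≤ δ → f ∈ (V (δ - 3) μ).map (LinearMap.mulLeft ℂ cub)) ∧ (δ < 3 → f = 0) := by
  obtain ⟨_, ⟨g, hg, rfl⟩, r, hr, rfl⟩ := Submodule.mem_sup.1 (division δ hf.1)
  have : r = 0 := by
    apply R_inj δ r hr
    simpa [R_cub] using h
  subst this
  rw [SetLike.mem_coe, mem_restrictSupport_iff] at hg
  simp only [add_zero] at hf ⊢
  constructor
  · intro h3
    refine ⟨g, ⟨?_, fun i => ?_⟩, rfl⟩
    · have : g ∈ homogeneousSubmodule (Fin 3) ℂ (δ - 3) := by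
        rw [homogeneousSubmodule_eq_finsupp_supported]
        intro d hd
        have := hg hd
        simp only [Set.mem_ofPred_eq] at this ⊢
        omega
      exact this
    · exact van_mul (pt i) μ cub g (Finsupp.single 2 1) (by simp) (cub_tau _) (hf.2 i)
  · intro h3
    have : g = 0 := by
      by_contra hne
      obtain ⟨d, hd⟩ := MvPolynomial.ne_zero_iff.1 hne
      have := hg (mem_support_iff.2 hd)
      simp only [Set.mem_ofPred_eq] at this
      omega
    simp [this]

/-- product of the linear factors -/
noncomputable def Pi9 : Polynomial ℂ :=
  ∏ i : Fin 9, (Polynomial.X - Polynomial.C (((i : ℕ) : ℂ)))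

lemma Pi9_monic : Pi9.Monic := Polynomial.monic_prod_of_monic _ _ fun i _ => Polynomial.monic_X_sub_C _

lemma Pi9_deg : Pi9.natDegree = 9 := by
  rw [Pi9, Polynomial.natDegree_prod_of_monic _ _ fun i _ => Polynomial.monic_X_sub_C _]
  simp only [Polynomial.natDegree_X_sub_C]
  simp

lemma Pi9_next : Pi9.nextCoeff = -36 := by
  rw [Pi9, Polynomial.Monic.nextCoeff_prod _ _ fun i _ => Polynomial.monic_X_sub_C _]
  simp only [Polynomial.nextCoeff_X_sub_C, Fin.sum_univ_succ]
  simp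
  norm_num

lemma Pi9_dvd (δ μ : ℕ) (f : P3) (hf : f ∈ V δ μ) : Pi9 ^ μ ∣ R f := by
  rw [Pi9, ← Finset.prod_pow]
  apply Finset.prod_dvd_of_coprime
  · intro i _ j _ hij
    apply IsCoprime.pow
    apply Polynomial.isCoprime_X_sub_C_of_isUnit_sub
    rw [isUnit_iff_ne_zero, sub_ne_zero]
    intro h
    exact hij (Fin.ext (by exact_mod_cast h))
  · intro i _
    exact R_dvd _ _ _ (hf.2 i)

noncomputable def topL (δ μ : ℕ) : P3 →ₗ[ℂ] (Fin (3 * (δ - 3 * μ)) → ℂ) :=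
  LinearMap.pi fun j =>
    (Polynomial.lcoeff ℂ (if (j : ℕ) + 1 = 3 * (δ - 3 * μ) then 3 * δ else 9 * μ + j)) ∘ₗ
      R.toLinearMap

lemma top_zero (δ μ : ℕ) (f : P3) (hf : f ∈ V δ (μ + 1)) (h : topL δ (μ + 1) f = 0) :
    R f = 0 := by
  set m := μ + 1 with hm
  have hdvd := Pi9_dvd _ _ _ hf
  have hmon : (Pi9 ^ m).Monic := Pi9_monic.pow m
  have hdeg : (Pi9 ^ m).natDegree = 9 * m := by rw [Pi9_monic.natDegree_pow, Pi9_deg]; ring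
  have hR := R_coeff δ f hf.1
  have hj : ∀ j < 3 * (δ - 3 * m),
      (R f).coeff (if j + 1 = 3 * (δ - 3 * m) then 3 * δ else 9 * m + j) = 0 := by
    intro j hj
    exact congrFun h ⟨j, hj⟩
  by_cases hk : δ = 3 * m
  · obtain ⟨Q, hQ⟩ := hdvd
    by_contra hne
    have hQ0 : Q ≠ 0 := by rintro rfl; exact hne (by rw [hQ, mul_zero])
    have hle : (R f).natDegree ≤ 9 * m := by
      rw [Polynomial.natDegree_le_iff_coeff_eq_zero]
      intro N hN
      exact hR N (by left; omega)
    rw [hQ, hmon.natDegree_mul' hQ0, hdeg] at hle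
    obtain ⟨q, rfl⟩ := Polynomial.natDegree_eq_zero.1 (show Q.natDegree = 0 by omega)
    have hc := hR (9 * m - 1) (by right; omega)
    rw [hQ, Polynomial.coeff_mul_C, ← hdeg,
      ← Polynomial.nextCoeff_of_natDegree_pos (by rw [hdeg]; omega),
      Pi9_monic.nextCoeff_pow, Pi9_next, hm] at hc
    have hq : q ≠ 0 := by rintro rfl; simp at hQ0
    simp only [nsmul_eq_mul, mul_eq_zero, hq, or_false] at hc
    rcases hc with hc | hc
    · exact Nat.cast_ne_zero.2 (Nat.succ_ne_zero μ) hc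
    · norm_num at hc
  · by_contra hne
    have hle := Polynomial.natDegree_le_of_dvd hdvd hne
    rw [hdeg] at hle
    have hlc : (R f).coeff (R f).natDegree ≠ 0 := by
      rw [Polynomial.coeff_natDegree]; exact Polynomial.leadingCoeff_ne_zero.2 hne
    set n := (R f).natDegree
    apply hlc
    by_cases h1 : 3 * δ < n ∨ n + 1 = 3 * δ
    · exact hR n h1
    by_cases h2 : n = 3 * δ
    · have := hj (3 * (δ - 3 * m) - 1) (by omega)
      rw [if_pos (by omega)] at this
      rwa [h2]
    · have := hj (n - 9 * m) (by omega)
      rw [if_neg (by omega)] at this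
      rwa [show 9 * m + (n - 9 * m) = n by omega] at this

lemma step_small (δ μ : ℕ) (h3 : δ < 3) : Module.finrank ℂ (V δ (μ + 1)) = 0 := by
  have := finrank_le_of_ker (V δ (μ + 1)) ⊥ (topL δ (μ + 1)) (fun f hf h =>
    (ker_R δ μ f hf (top_zero δ μ f hf h)).2 h3)
  rw [finrank_bot, Fintype.card_fin] at this
  omega

lemma step (δ μ : ℕ) : Module.finrank ℂ (V (δ + 3) (μ + 1)) ≤
    3 * (δ - 3 * μ) + Module.finrank ℂ (V δ μ) := by
  have := finrank_le_of_ker (V (δ + 3) (μ + 1)) ((V δ μ).map (LinearMap.mulLeft ℂ cub))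
    (topL (δ + 3) (μ + 1)) (fun f hf h =>
      (ker_R (δ + 3) μ f hf (top_zero (δ + 3) μ f hf h)).1 (by omega))
  rw [Fintype.card_fin] at this
  have h2 := Submodule.finrank_map_le (LinearMap.mulLeft ℂ cub) (V δ μ)
  rw [show δ + 3 - 3 * (μ + 1) = δ - 3 * μ by omega] at this
  omega

lemma upper_neg (μ : ℕ) : ∀ δ, δ < 3 * μ → Module.finrank ℂ (V δ μ) = 0 := by
  induction μ with
  | zero => intro δ h; omega
  | succ μ ih =>
    intro δ h
    by_cases h3 : δ < 3
    · exact step_small δ μ h3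
    · obtain ⟨e, rfl⟩ : ∃ e, δ = e + 3 := ⟨δ - 3, by omega⟩
      have := step e μ
      rw [ih e (by omega)] at this
      omega

lemma upper_pos (μ k : ℕ) : Module.finrank ℂ (V (3 * μ + k) μ) ≤ 3 * k * μ + (k + 2).choose 2 := by
  induction μ with
  | zero =>
    rw [← finrank_hom]
    have e : 3 * 0 + k = k := by omega
    rw [e, mul_zero, zero_add]
    exact Submodule.finrank_mono (V_le k 0)
  | succ μ ih =>
    have := step (3 * μ + k) μ
    rw [show 3 * (μ + 1) + k = 3 * μ + k + 3 by ring]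
    rw [show 3 * μ + k - 3 * μ = k by omega] at this
    nlinarith

lemma tri (n : ℕ) : 2 * (n + 1).choose 2 = n * (n + 1) := by
  have := Nat.triangle_succ n
  rw [Nat.choose_two_right, Nat.mul_div_cancel' (even_iff_two_dvd.1 (by simpa [mul_comm] using Nat.even_mul_succ_self n))]
  simp [mul_comm]

lemma final (δ μ : ℕ) : (Module.finrank ℂ (V δ μ) : ℤ) =
    max 0 (((δ : ℤ) + 1) * ((δ : ℤ) + 2) / 2 - 9 * ((μ : ℤ) * (μ + 1) / 2)) := by
  have h1 : ((δ : ℤ) + 1) * ((δ : ℤ) + 2) / 2 = (δ + 2).choose 2 := by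
    have := tri (δ + 1)
    zify at this
    apply Int.ediv_eq_of_eq_mul_right (by norm_num)
    linarith
  have h2 : (μ : ℤ) * (μ + 1) / 2 = (μ + 1).choose 2 := by
    have := tri μ
    zify at this
    apply Int.ediv_eq_of_eq_mul_right (by norm_num)
    linarith
  rw [h1, h2]
  have hl := lower δ μ
  zify at hl
  by_cases h : δ < 3 * μ
  · have hu := upper_neg μ δ h
    rw [hu] at hl ⊢
    rw [max_eq_left (by push_cast at hl ⊢; linarith)]
    rfl
  · obtain ⟨k, rfl⟩ : ∃ k, δ = 3 * μ + k := ⟨δ - 3 * μ, by omega⟩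
    have hu := upper_pos μ k
    have t1 := tri (3 * μ + k + 1)
    have t2 := tri μ
    have t3 := tri (k + 1)
    have e : (3 * μ + k + 2).choose 2 = 9 * (μ + 1).choose 2 + (3 * k * μ + (k + 2).choose 2) := by
      nlinarith
    zify at hu e
    rw [max_eq_right]
    · push_cast at *; linarith
    · push_cast at *; rw [e]; ring_nf; positivity

end NinePts

/-- Lemma 4.2 (case `c = 9`): on `ℙ²` over `ℂ`, the system of plane curves of degree
`δ` through `9` general points of multiplicity `μ` is non-special: the space of
degree-`δ` forms vanishing to order `≥ μ` at the points has dimension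
`max 0 ((δ+1)(δ+2)/2 - 9·μ(μ+1)/2)`. -/
theorem stmt18 (δ μ : ℕ) :
    ∃ p : Fin 9 → (Fin 3 → ℂ), (∀ i, p i ≠ 0) ∧
      ∃ V : Submodule ℂ (MvPolynomial (Fin 3) ℂ),
        (V : Set (MvPolynomial (Fin 3) ℂ)) =
          {f | f.IsHomogeneous δ ∧ ∀ i, ∀ m : Fin 3 → ℕ,
              m 0 + m 1 + m 2 < μ →
              eval (p i)
                ((⇑(pderiv (0 : Fin 3)))^[m 0]
                  ((⇑(pderiv (1 : Fin 3)))^[m 1]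
                    ((⇑(pderiv (2 : Fin 3)))^[m 2] f))) = 0} ∧
        (Module.finrank ℂ V : ℤ) =
          max 0 (((δ : ℤ) + 1) * ((δ : ℤ) + 2) / 2 - 9 * ((μ : ℤ) * (μ + 1) / 2)) := by
  refine ⟨NinePts.pt, fun i h => ?_, NinePts.V δ μ, ?_, NinePts.final δ μ⟩
  · have := congrFun h 1
    simp [NinePts.pt, NinePts.cpt] at this
  · ext f
    constructor
    · rintro ⟨h1, h2⟩
      exact ⟨h1, fun i m hm => h2 i _ _ _ hm⟩
    · rintro ⟨h1, h2⟩
      exact ⟨h1, fun i a b c hm => h2 i ![a, b, c] hm⟩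
end
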